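/- arXiv:2503.18564 — 2 statements merged into one kernel-verified Lean document; each statement's English description precedes it below -/
import Mathlib

section
/- Let m ≥ 6 be an even integer and let G = D_{2m} be the dihedral group of order 2m generated by two reflections r₀ and r₁ whose product r₀r₁ has order m, and set r₂ = (r₀r₁)^{m/2}. Then (r₀, r₁, r₂) is a regular linear hypermap triple for G; moreover, the subgroups ⟨r₁,r₂⟩ and ⟨r₀,r₂⟩ each have index m/2 in G, ⟨r₀,r₁⟩ = G, and ⟨r₀r₂, r₁r₂⟩ = G. -/
open Pointwise

/-- `(r₀, r₁, r₂)` is a regular linear hypermap triple for the group `G`. -/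
def IsRLHTriple {G : Type*} [Group G] (r₀ r₁ r₂ : G) : Prop :=
  orderOf r₀ = 2 ∧ orderOf r₁ = 2 ∧ orderOf r₂ = 2 ∧
  r₀ ≠ r₁ ∧ r₀ ≠ r₂ ∧ r₁ ≠ r₂ ∧
  Subgroup.closure {r₀, r₁, r₂} = (⊤ : Subgroup G) ∧
  Subgroup.closure {r₁, r₂} ⊓ Subgroup.closure {r₀, r₂} = Subgroup.closure {r₂} ∧
  ((Subgroup.closure {r₁, r₂} : Set G) * (Subgroup.closure {r₀, r₂} : Set G)) ∩
      ((Subgroup.closure {r₀, r₂} : Set G) * (Subgroup.closure {r₁, r₂} : Set G)) =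
    (Subgroup.closure {r₁, r₂} : Set G) ∪ (Subgroup.closure {r₀, r₂} : Set G)

section DihedralPresentation

variable {G : Type*} [Group G]

/-- The homomorphism `ZMod m → G` sending `1` to `ρ`, where `ρ ^ m = 1`. -/
def zmodPowHom (m : ℕ) (ρ : G) (h : ρ ^ m = 1) : ZMod m →+ Additive G :=
  ZMod.lift m ⟨zmultiplesHom (Additive G) (Additive.ofMul ρ), by
    simpa [← ofMul_pow] using h⟩

lemma zmodPowHom_intCast (m : ℕ) (ρ : G) (h : ρ ^ m = 1) (k : ℤ) :
    (zmodPowHom m ρ h (k : ZMod m)).toMul = ρ ^ k := by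
  simp [zmodPowHom]

lemma conj_zpow_of_involutions {a b : G} (ha : a * a = 1) (hb : b * b = 1) (k : ℤ) :
    a * (a * b) ^ k = (a * b) ^ (-k) * a := by
  have ha' : a⁻¹ = a := inv_eq_of_mul_eq_one_right ha
  have hb' : b⁻¹ = b := inv_eq_of_mul_eq_one_right hb
  have h : SemiconjBy a (a * b) (a * b)⁻¹ := by
    simp [SemiconjBy, ha', hb', mul_assoc]
    simp [← mul_assoc, ha]
  simpa only [inv_zpow'] using (h.zpow_right k).eq

/-- The homomorphism from a dihedral group determined by two involutions. -/
def dihedralHom (m : ℕ) (a b : G) (ha : a * a = 1) (hb : b * b = 1) (h : (a * b) ^ m = 1) :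
    DihedralGroup m →* G :=
  MonoidHom.mk' (fun x => match x with
    | .r i => (zmodPowHom m (a * b) h i).toMul
    | .sr i => a * (zmodPowHom m (a * b) h i).toMul) (by
    rintro (i | i) (j | j) <;>
      obtain ⟨i, rfl⟩ := ZMod.intCast_surjective i <;>
      obtain ⟨j, rfl⟩ := ZMod.intCast_surjective j <;>
      simp only [DihedralGroup.r_mul_r, DihedralGroup.r_mul_sr, DihedralGroup.sr_mul_r,
        DihedralGroup.sr_mul_sr, ← Int.cast_add, ← Int.cast_sub, zmodPowHom_intCast]
    · exact zpow_add _ _ _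
    · rw [sub_eq_neg_add, zpow_add, ← mul_assoc, conj_zpow_of_involutions ha hb, neg_neg,
        mul_assoc]
    · rw [zpow_add, mul_assoc]
    · rw [conj_zpow_of_involutions ha hb, sub_eq_neg_add, zpow_add, mul_assoc, ← mul_assoc a a,
        ha, one_mul])

lemma dihedralHom_r {m : ℕ} {a b : G} (ha : a * a = 1) (hb : b * b = 1) (h : (a * b) ^ m = 1)
    (k : ℤ) : dihedralHom m a b ha hb h (.r k) = (a * b) ^ k :=
  zmodPowHom_intCast m _ h k

lemma dihedralHom_sr {m : ℕ} {a b : G} (ha : a * a = 1) (hb : b * b = 1) (h : (a * b) ^ m = 1)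
    (k : ℤ) : dihedralHom m a b ha hb h (.sr k) = a * (a * b) ^ k :=
  congrArg (a * ·) (zmodPowHom_intCast m _ h k)

lemma mul_sq_eq_one_of_commute {a b : G} (ha : a * a = 1) (hb : b * b = 1)
    (h : a * (a * b) = (a * b) * a) : (a * b) ^ 2 = 1 := by
  rw [pow_two, ← mul_assoc, ← h, ← mul_assoc, ha, one_mul, hb]

/-- Two involutions whose product has order `m > 2` and which generate `G` identify `G` with the
dihedral group of order `2 * m`. -/
lemma nonempty_mulEquiv_dihedralGroup {m : ℕ} {a b : G} (ha : a * a = 1) (hb : b * b = 1)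
    (hm : orderOf (a * b) = m) (h2 : (a * b) ^ 2 ≠ 1)
    (hgen : Subgroup.closure ({a, b} : Set G) = ⊤) : Nonempty (G ≃* DihedralGroup m) := by
  have h : (a * b) ^ m = 1 := hm ▸ pow_orderOf_eq_one _
  refine ⟨(MulEquiv.ofBijective (dihedralHom m a b ha hb h) ⟨?_, ?_⟩).symm⟩
  · rw [injective_iff_map_eq_one]
    rintro (i | i) hi <;> obtain ⟨i, rfl⟩ := ZMod.intCast_surjective i
    · rw [dihedralHom_r, ← orderOf_dvd_iff_zpow_eq_one, hm,
        ← ZMod.intCast_zmod_eq_zero_iff_dvd] at hi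
      rw [hi, DihedralGroup.r_zero]
    · rw [dihedralHom_sr] at hi
      refine absurd (mul_sq_eq_one_of_commute ha hb ?_) h2
      have hc : Commute ((a * b) ^ (-i)) (a * b) := (Commute.refl (a * b)).zpow_left _
      rw [zpow_neg, ← eq_inv_of_mul_eq_one_left hi] at hc
      exact hc.eq
  · rw [← MonoidHom.range_eq_top, eq_top_iff, ← hgen, Subgroup.closure_le]
    have hs : a ∈ (dihedralHom m a b ha hb h).range :=
      ⟨.sr ((0 : ℤ) : ZMod m), by rw [dihedralHom_sr, zpow_zero, mul_one]⟩
    have hr : a * b ∈ (dihedralHom m a b ha hb h).range :=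
      ⟨.r ((1 : ℤ) : ZMod m), by rw [dihedralHom_r, zpow_one]⟩
    rintro x (rfl | rfl)
    · exact hs
    · exact (Subgroup.mul_mem_cancel_left _ hs).1 hr

lemma mem_closure_pair_involutions {a z : G} (ha : a * a = 1) (hz : z * z = 1)
    (haz : a * z = z * a) (x : G) :
    x ∈ Subgroup.closure ({a, z} : Set G) ↔ x = 1 ∨ x = a ∨ x = z ∨ x = a * z := by
  constructor
  · intro hx
    have ha' : a⁻¹ = a := inv_eq_of_mul_eq_one_right ha
    have hz' : z⁻¹ = z := inv_eq_of_mul_eq_one_right hz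
    have haa (y : G) : a * (a * y) = y := by rw [← mul_assoc, ha, one_mul]
    induction hx using Subgroup.closure_induction_left with
    | one => exact .inl rfl
    | mul_left g hg y _ ih =>
      rcases hg with rfl | rfl <;> rcases ih with rfl | rfl | rfl | rfl <;> grind
    | inv_mul_cancel g hg y _ ih =>
      rcases hg with rfl | rfl <;> rcases ih with rfl | rfl | rfl | rfl <;> grind
  · have h₁ : a ∈ Subgroup.closure ({a, z} : Set G) := Subgroup.subset_closure (by simp)
    have h₂ : z ∈ Subgroup.closure ({a, z} : Set G) := Subgroup.subset_closure (by simp)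
    rintro (rfl | rfl | rfl | rfl)
    · exact one_mem _
    · exact h₁
    · exact h₂
    · exact mul_mem h₁ h₂

lemma card_closure_pair_involutions {a z : G} (ha : a * a = 1) (hz : z * z = 1)
    (haz : a * z = z * a) (ha1 : a ≠ 1) (hz1 : z ≠ 1) (hne : a ≠ z) :
    Nat.card (Subgroup.closure ({a, z} : Set G)) = 4 := by
  classical
  have hset : (Subgroup.closure ({a, z} : Set G) : Set G) =
      (({1, a, z, a * z} : Finset G) : Set G) := by
    ext x
    simp [mem_closure_pair_involutions ha hz haz]
  have haz1 : a * z ≠ 1 := fun h => hne (by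
    rw [eq_inv_of_mul_eq_one_left h, inv_eq_of_mul_eq_one_right hz])
  rw [← SetLike.coe_sort_coe, hset, Nat.card_eq_card_toFinset, Finset.toFinset_coe]
  rw [Finset.card_insert_of_notMem, Finset.card_insert_of_notMem, Finset.card_insert_of_notMem,
    Finset.card_singleton]
  · simpa using ha1
  · simp [hne, hz1]
  · simp [ha1.symm, hz1.symm, haz1.symm]

end DihedralPresentation

theorem stmt_10 {G : Type*} [Group G] [Fintype G] (m : ℕ) (hm6 : 6 ≤ m) (hmeven : Even m)
    (r₀ r₁ r₂ : G)
    (h0 : orderOf r₀ = 2) (h1 : orderOf r₁ = 2)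
    (hm : orderOf (r₀ * r₁) = m)
    (hgen : Subgroup.closure ({r₀, r₁} : Set G) = ⊤)
    (hr₂ : r₂ = (r₀ * r₁) ^ (m / 2)) :
    IsRLHTriple r₀ r₁ r₂ ∧
    (Subgroup.closure {r₁, r₂}).index = m / 2 ∧
    (Subgroup.closure {r₀, r₂}).index = m / 2 ∧
    Subgroup.closure ({r₀, r₁} : Set G) = ⊤ ∧
    Subgroup.closure ({r₀ * r₂, r₁ * r₂} : Set G) = ⊤ ∧
    Nonempty (G ≃* DihedralGroup m) := by
  obtain ⟨k, hk⟩ := hmeven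
  have hk2 : m / 2 = k := by omega
  rw [hk2] at hr₂ ⊢
  have ha : r₀ * r₀ = 1 := by rw [← pow_two, ← h0, pow_orderOf_eq_one]
  have hb : r₁ * r₁ = 1 := by rw [← pow_two, ← h1, pow_orderOf_eq_one]
  have hz : r₂ * r₂ = 1 := by rw [hr₂, ← pow_add, ← hk, ← hm, pow_orderOf_eq_one]
  have hpow (n : ℕ) (hn : 0 < n) (hnm : n < m) : (r₀ * r₁) ^ n ≠ 1 :=
    pow_ne_one_of_lt_orderOf hn.ne' (hm ▸ hnm)
  have hρ2 : (r₀ * r₁) ^ 2 ≠ 1 := hpow 2 (by omega) (by omega)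
  have hρ4 : (r₀ * r₁) ^ 4 ≠ 1 := hpow 4 (by omega) (by omega)
  have ha1 : r₀ ≠ 1 := fun h => by simp [h] at h0
  have hb1 : r₁ ≠ 1 := fun h => by simp [h] at h1
  have hz1 : r₂ ≠ 1 := hr₂ ▸ hpow k (by omega) (by omega)
  have hz' : r₂⁻¹ = r₂ := inv_eq_of_mul_eq_one_right hz
  have haz : r₀ * r₂ = r₂ * r₀ := by
    have := conj_zpow_of_involutions ha hb k
    rwa [zpow_neg, zpow_natCast, ← hr₂, hz'] at this
  have hρz : (r₀ * r₁) * r₂ = r₂ * (r₀ * r₁) := by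
    rw [hr₂]; exact ((Commute.refl (r₀ * r₁)).pow_right k).eq
  have hbz : r₁ * r₂ = r₂ * r₁ := by
    have h : r₁ = r₀ * (r₀ * r₁) := by rw [← mul_assoc, ha, one_mul]
    have hc : Commute (r₀ * (r₀ * r₁)) r₂ := Commute.mul_left haz hρz
    rw [← h] at hc
    exact hc
  have hneaz : r₀ ≠ r₂ := fun h =>
    hρ2 (mul_sq_eq_one_of_commute ha hb (by nth_rw 1 [h]; rw [← hρz, ← h]))
  have hab_sq (h : r₀ * r₁ = r₁ * r₀) : False := hρ2 (by
    apply mul_sq_eq_one_of_commute ha hb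
    rw [mul_assoc, ← h])
  have hnebz : r₁ ≠ r₂ := fun h => hab_sq (by rw [h, haz])
  have hneab : r₀ ≠ r₁ := fun h => hab_sq (by rw [h])
  have hneabz : r₀ ≠ r₁ * r₂ := fun h => hab_sq (by
    rw [h, mul_assoc, ← hbz])
  have hiso := nonempty_mulEquiv_dihedralGroup ha hb hm hρ2 hgen
  have hcard : Nat.card G = 2 * m := by
    obtain ⟨e⟩ := hiso
    rw [Nat.card_congr e.toEquiv, DihedralGroup.nat_card]
  have hA := mem_closure_pair_involutions hb hz hbz
  have hB := mem_closure_pair_involutions ha hz haz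
  have hAcard := card_closure_pair_involutions hb hz hbz hb1 hz1 hnebz
  have hBcard := card_closure_pair_involutions ha hz haz ha1 hz1 hneaz
  have haa (y : G) : r₀ * (r₀ * y) = y := by rw [← mul_assoc, ha, one_mul]
  have hbb (y : G) : r₁ * (r₁ * y) = y := by rw [← mul_assoc, hb, one_mul]
  have hza' (y : G) : r₂ * (r₀ * y) = r₀ * (r₂ * y) := by rw [← mul_assoc, ← haz, mul_assoc]
  have hzb' (y : G) : r₂ * (r₁ * y) = r₁ * (r₂ * y) := by rw [← mul_assoc, ← hbz, mul_assoc]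
  have hbaz : r₁ * r₀ ≠ r₀ * (r₁ * r₂) := fun h => by
    have hsq : (r₀ * r₁) ^ 2 = r₂ := by
      rw [pow_two, mul_assoc, ← mul_assoc r₁, h]
      simp only [mul_assoc, haa, hbb, ← hbz]
    exact hρ4 (by rw [show 4 = 2 * 2 from rfl, pow_mul, hsq, pow_two, hz])
  refine ⟨⟨h0, h1, ?_, hneab, hneaz, hnebz, ?_, ?_, ?_⟩, ?_, ?_, hgen, ?_, hiso⟩
  · exact orderOf_eq_prime (by rw [pow_two, hz]) hz1
  · rw [eq_top_iff, ← hgen]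
    exact Subgroup.closure_mono (by rintro x (rfl | rfl) <;> simp)
  · apply le_antisymm
    · rintro x ⟨hx, hy⟩
      have hzmem : r₂ ∈ Subgroup.closure ({r₂} : Set G) := Subgroup.subset_closure rfl
      have key : x = 1 ∨ x = r₂ := by
        have := (hA x).1 hx
        have := (hB x).1 hy
        grind
      rcases key with rfl | rfl
      · exact one_mem _
      · exact hzmem
    · exact le_inf (Subgroup.closure_mono (by simp)) (Subgroup.closure_mono (by simp))
  · apply Set.Subset.antisymm
    · rintro x ⟨⟨a, haA, b, hbB, rfl⟩, ⟨c, hcB, d, hdA, hcd⟩⟩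
      have haA := (hA a).1 haA
      have hbB := (hB b).1 hbB
      have hcB := (hB c).1 hcB
      have hdA := (hA d).1 hdA
      simp only [Set.mem_union, SetLike.mem_coe, hA, hB]
      have hcd : c * d = a * b := hcd
      have hl : (a * b = 1 ∨ a * b = r₁ ∨ a * b = r₂ ∨ a * b = r₁ * r₂) ∨
          (a * b = 1 ∨ a * b = r₀ ∨ a * b = r₂ ∨ a * b = r₀ * r₂) ∨
          a * b = r₁ * r₀ ∨ a * b = r₁ * (r₀ * r₂) := by
        rcases haA with rfl | rfl | rfl | rfl <;> rcases hbB with rfl | rfl | rfl | rfl <;>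
          simp [mul_assoc, ← haz, hza', hz]
      have hr : (c * d = 1 ∨ c * d = r₁ ∨ c * d = r₂ ∨ c * d = r₁ * r₂) ∨
          (c * d = 1 ∨ c * d = r₀ ∨ c * d = r₂ ∨ c * d = r₀ * r₂) ∨
          c * d = r₀ * r₁ ∨ c * d = r₀ * (r₁ * r₂) := by
        rcases hcB with rfl | rfl | rfl | rfl <;> rcases hdA with rfl | rfl | rfl | rfl <;>
          simp [mul_assoc, ← hbz, hzb', hz]
      rw [hcd] at hr
      rcases hl with hl | hl | hl
      · exact .inl hl
      · exact .inr hl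
      rcases hr with hr | hr | hr
      · exact .inl hr
      · exact .inr hr
      exfalso
      rcases hl with hl | hl <;> rcases hr with hr | hr <;> rw [hl] at hr
      · exact hab_sq hr.symm
      · exact hbaz hr
      · refine hbaz ?_
        have := congrArg (· * r₂) hr
        simpa [mul_assoc, hz] using this
      · rw [← mul_assoc, ← mul_assoc] at hr
        exact hab_sq (mul_right_cancel hr).symm
    · rintro x (hx | hx)
      · exact ⟨⟨x, hx, 1, one_mem _, mul_one x⟩, ⟨1, one_mem _, x, hx, one_mul x⟩⟩
      · exact ⟨⟨1, one_mem _, x, hx, one_mul x⟩, ⟨x, hx, 1, one_mem _, mul_one x⟩⟩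
  · have := (Subgroup.closure ({r₁, r₂} : Set G)).card_mul_index
    rw [hAcard, hcard] at this
    omega
  · have := (Subgroup.closure ({r₀, r₂} : Set G)).card_mul_index
    rw [hBcard, hcard] at this
    omega
  · set H := Subgroup.closure ({r₀ * r₂, r₁ * r₂} : Set G)
    have h₀ : r₀ * r₂ ∈ H := Subgroup.subset_closure (by simp)
    have h₁ : r₁ * r₂ ∈ H := Subgroup.subset_closure (by simp)
    have hρ : r₀ * r₁ ∈ H := by
      have := mul_mem h₀ h₁
      rwa [mul_assoc, hzb', hz, mul_one] at this
    have h₂ : r₂ ∈ H := hr₂ ▸ pow_mem hρ k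
    rw [eq_top_iff, ← hgen, Subgroup.closure_le]
    rintro x (rfl | rfl)
    · exact (Subgroup.mul_mem_cancel_right _ h₂).1 h₀
    · exact (Subgroup.mul_mem_cancel_right _ h₂).1 h₁
end

section
/- Let G = A₅ × C₂, where A₅ is the alternating group on {1,2,3,4,5} and a denotes the generator of the C₂ factor; write πa for the element (π, a) and π for (π, 1). Set r₀ = (1 2)(3 5), r₁ = (1 2)(3 4)a, r₂ = (1 4)(2 3). Then (r₀, r₁, r₂) is a regular linear hypermap triple for G; the orders of r₁r₂, r₀r₂, r₀r₁ are 2, 5, 6 respectively; the subgroups ⟨r₁,r₂⟩, ⟨r₀,r₂⟩, ⟨r₀,r₁⟩ have indices 30, 12, 10 in G respectively; and ⟨r₀r₂, r₁r₂⟩ = G. -/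
open Pointwise

/-- The elements `(s * t) ^ k` and `(s * t) ^ k * s` with `k < n`. -/
def dihedralFinset {G : Type*} [Group G] [DecidableEq G] (s t : G) (n : ℕ) : Finset G :=
  (Finset.range n).image (fun k => (s * t) ^ k) ∪ (Finset.range n).image (fun k => (s * t) ^ k * s)

lemma mem_closure_pair_iff_of_mul_self {G : Type*} [Group G] {s t : G}
    (hs : s * s = 1) (ht : t * t = 1) {x : G} :
    x ∈ Subgroup.closure {s, t} ↔ ∃ k : ℤ, x = (s * t) ^ k ∨ x = (s * t) ^ k * s := by
  have hs' : s⁻¹ = s := inv_eq_of_mul_eq_one_left hs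
  have ht' : t⁻¹ = t := inv_eq_of_mul_eq_one_left ht
  have hconj (k : ℤ) : s * (s * t) ^ k = (s * t) ^ (-k) * s := by
    have h : (s * (s * t) * s⁻¹) ^ k = s * (s * t) ^ k * s⁻¹ := conj_zpow
    have h' : s * (s * t) * s⁻¹ = (s * t)⁻¹ := by
      rw [mul_inv_rev, hs', ht', ← mul_assoc, hs, one_mul]
    rw [h', inv_zpow', eq_mul_inv_iff_mul_eq] at h
    exact h.symm
  have hmul (y : G) (hy : ∃ k : ℤ, y = (s * t) ^ k ∨ y = (s * t) ^ k * s) :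
      ∃ k : ℤ, s * y = (s * t) ^ k ∨ s * y = (s * t) ^ k * s := by
    obtain ⟨k, rfl | rfl⟩ := hy
    · exact ⟨-k, Or.inr (hconj k)⟩
    · exact ⟨-k, Or.inl (by rw [← mul_assoc, hconj, mul_assoc, hs, mul_one])⟩
  have hrot (y : G) (hy : ∃ k : ℤ, y = (s * t) ^ k ∨ y = (s * t) ^ k * s) :
      ∃ k : ℤ, (s * t) * y = (s * t) ^ k ∨ (s * t) * y = (s * t) ^ k * s := by
    obtain ⟨k, rfl | rfl⟩ := hy
    · exact ⟨1 + k, Or.inl (by rw [zpow_one_add])⟩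
    · exact ⟨1 + k, Or.inr (by rw [zpow_one_add, ← mul_assoc])⟩
  have hgen (a : G) (ha : a ∈ ({s, t} : Set G)) (y : G)
      (hy : ∃ k : ℤ, y = (s * t) ^ k ∨ y = (s * t) ^ k * s) :
      ∃ k : ℤ, a * y = (s * t) ^ k ∨ a * y = (s * t) ^ k * s := by
    rcases ha with rfl | rfl
    · exact hmul y hy
    · have := hmul _ (hrot y hy)
      rwa [← mul_assoc, ← mul_assoc, hs, one_mul] at this
  constructor
  · intro hx
    induction hx using Subgroup.closure_induction_left with
    | one => exact ⟨0, Or.inl (zpow_zero _).symm⟩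
    | mul_left a ha y _ ih => exact hgen a ha y ih
    | inv_mul_cancel a ha y _ ih =>
      have : a⁻¹ = a := by rcases ha with rfl | rfl <;> assumption
      rw [this]
      exact hgen a ha y ih
  · have hs₁ : s ∈ Subgroup.closure {s, t} := Subgroup.subset_closure (by simp)
    have ht₁ : t ∈ Subgroup.closure {s, t} := Subgroup.subset_closure (by simp)
    rintro ⟨k, rfl | rfl⟩
    · exact zpow_mem (mul_mem hs₁ ht₁) k
    · exact mul_mem (zpow_mem (mul_mem hs₁ ht₁) k) hs₁

lemma coe_closure_pair_eq_dihedralFinset {G : Type*} [Group G] [DecidableEq G] {s t : G} {n : ℕ}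
    (hs : s * s = 1) (ht : t * t = 1) (hn : n ≠ 0) (hst : (s * t) ^ n = 1) :
    (Subgroup.closure {s, t} : Set G) = dihedralFinset s t n := by
  ext x
  simp only [SetLike.mem_coe, mem_closure_pair_iff_of_mul_self hs ht, dihedralFinset,
    Finset.mem_union, Finset.mem_image, Finset.mem_range]
  constructor
  · rintro ⟨k, hk⟩
    have hmod : (s * t) ^ k = (s * t) ^ (k % n).toNat := by
      rw [← zpow_natCast, Int.toNat_of_nonneg (Int.emod_nonneg k (by exact_mod_cast hn))]
      conv_lhs => rw [← Int.emod_add_mul_ediv k n]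
      rw [zpow_add, zpow_mul, zpow_natCast, hst, one_zpow, mul_one]
    have hlt : (k % n).toNat < n := by
      have := Int.emod_lt_of_pos k (b := n) (by omega)
      omega
    rw [hmod] at hk
    rcases hk with rfl | rfl
    · exact Or.inl ⟨_, hlt, rfl⟩
    · exact Or.inr ⟨_, hlt, rfl⟩
  · rintro (⟨k, -, rfl⟩ | ⟨k, -, rfl⟩)
    · exact ⟨k, Or.inl (by rw [zpow_natCast])⟩
    · exact ⟨k, Or.inr (by rw [zpow_natCast])⟩

lemma index_closure_pair {G : Type*} [Group G] [DecidableEq G] {s t : G} {n m : ℕ}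
    (hs : s * s = 1) (ht : t * t = 1) (hn : n ≠ 0) (hst : (s * t) ^ n = 1)
    (hm : (dihedralFinset s t n).card * m = Nat.card G) :
    (Subgroup.closure {s, t}).index = m := by
  have hcard : Nat.card (Subgroup.closure {s, t}) = (dihedralFinset s t n).card := by
    rw [← SetLike.coe_sort_coe, coe_closure_pair_eq_dihedralFinset hs ht hn hst]
    simp
  have hpos : (dihedralFinset s t n).card ≠ 0 := by
    rw [Finset.card_ne_zero]
    exact ⟨1, Finset.mem_union_left _
      (Finset.mem_image.mpr ⟨0, Finset.mem_range.mpr (Nat.pos_of_ne_zero hn), pow_zero _⟩)⟩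
  have h := (Subgroup.closure {s, t}).card_mul_index
  rw [hcard, ← hm] at h
  exact Nat.eq_of_mul_eq_mul_left (Nat.pos_of_ne_zero hpos) h

lemma Subgroup.eq_top_of_card_lt_two_mul {G : Type*} [Group G] [Finite G] (H : Subgroup G)
    (S : Finset G) (hS : ∀ x ∈ S, x ∈ H) (hcard : Nat.card G < 2 * S.card) : H = ⊤ := by
  have hle : S.card ≤ Nat.card H := by
    rw [← Nat.card_eq_finsetCard S]
    exact Nat.card_le_card_of_injective (fun x : S => (⟨x, hS x x.2⟩ : H))
      fun x y h => Subtype.ext (congrArg (fun z : H => (z : G)) h)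
  rw [← Subgroup.index_eq_one]
  have h := H.card_mul_index
  have h₀ : H.index ≠ 0 := Subgroup.index_ne_zero_of_finite
  by_contra h₁
  have : 2 ≤ H.index := by omega
  nlinarith

lemma card_alternatingGroup_five_prod :
    Nat.card (alternatingGroup (Fin 5) × Multiplicative (ZMod 2)) = 120 := by
  have h : Nat.card (Multiplicative (ZMod 2)) = 2 := by simp
  rw [Nat.card_prod, nat_card_alternatingGroup, h, Nat.card_fin]
  rfl

theorem stmt_17
    (r₀ r₁ r₂ : alternatingGroup (Fin 5) × Multiplicative (ZMod 2))
    (hr₀ : r₀ = (⟨Equiv.swap 0 1 * Equiv.swap 2 4, by simp [Equiv.Perm.mem_alternatingGroup]⟩, 1))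
    (hr₁ : r₁ = (⟨Equiv.swap 0 1 * Equiv.swap 2 3, by simp [Equiv.Perm.mem_alternatingGroup]⟩, Multiplicative.ofAdd 1))
    (hr₂ : r₂ = (⟨Equiv.swap 0 3 * Equiv.swap 1 2, by simp [Equiv.Perm.mem_alternatingGroup]⟩, 1)) :
    IsRLHTriple r₀ r₁ r₂ ∧
    orderOf (r₁ * r₂) = 2 ∧ orderOf (r₀ * r₂) = 5 ∧ orderOf (r₀ * r₁) = 6 ∧
    (Subgroup.closure {r₁, r₂}).index = 30 ∧
    (Subgroup.closure {r₀, r₂}).index = 12 ∧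
    (Subgroup.closure {r₀, r₁}).index = 10 ∧
    Subgroup.closure {r₀ * r₂, r₁ * r₂} = ⊤ := by
  have h₀ : r₀ * r₀ = 1 := by subst hr₀; decide +kernel
  have h₁ : r₁ * r₁ = 1 := by subst hr₁; decide +kernel
  have h₂ : r₂ * r₂ = 1 := by subst hr₂; decide +kernel
  have h₁₂ : (r₁ * r₂) ^ 2 = 1 := by subst hr₁ hr₂; decide +kernel
  have h₀₂ : (r₀ * r₂) ^ 5 = 1 := by subst hr₀ hr₂; decide +kernel
  have h₀₁ : (r₀ * r₁) ^ 6 = 1 := by subst hr₀ hr₁; decide +kernel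
  have hA := coe_closure_pair_eq_dihedralFinset h₁ h₂ two_ne_zero h₁₂
  have hB := coe_closure_pair_eq_dihedralFinset h₀ h₂ (by norm_num) h₀₂
  have htop : Subgroup.closure {r₀ * r₂, r₁ * r₂} = ⊤ := by
    have hu : r₀ * r₂ ∈ Subgroup.closure {r₀ * r₂, r₁ * r₂} := Subgroup.subset_closure (by simp)
    have hv : r₁ * r₂ ∈ Subgroup.closure {r₀ * r₂, r₁ * r₂} := Subgroup.subset_closure (by simp)
    refine Subgroup.eq_top_of_card_lt_two_mul _
      ((Finset.range 5 ×ˢ Finset.range 6 ×ˢ Finset.range 3).image fun p =>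
        (r₀ * r₂) ^ p.1 * ((r₀ * r₂) * (r₁ * r₂)) ^ p.2.1 *
          ((r₁ * r₂) * (r₀ * r₂) * (r₀ * r₂)) ^ p.2.2) ?_ ?_
    · intro x hx
      obtain ⟨p, -, rfl⟩ := Finset.mem_image.mp hx
      exact mul_mem (mul_mem (pow_mem hu _) (pow_mem (mul_mem hu hv) _))
        (pow_mem (mul_mem (mul_mem hv hu) hu) _)
    · rw [card_alternatingGroup_five_prod]
      subst hr₀ hr₁ hr₂
      decide +kernel
  refine ⟨⟨?_, ?_, ?_, ?_, ?_, ?_, ?_, ?_, ?_⟩, ?_, ?_, ?_, ?_, ?_, ?_, htop⟩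
  · exact orderOf_eq_prime (by rw [pow_two, h₀]) (by subst hr₀; decide +kernel)
  · exact orderOf_eq_prime (by rw [pow_two, h₁]) (by subst hr₁; decide +kernel)
  · exact orderOf_eq_prime (by rw [pow_two, h₂]) (by subst hr₂; decide +kernel)
  · subst hr₀ hr₁; decide +kernel
  · subst hr₀ hr₂; decide +kernel
  · subst hr₁ hr₂; decide +kernel
  · rw [eq_top_iff, ← htop, Subgroup.closure_le]
    have hm₀ : r₀ ∈ Subgroup.closure {r₀, r₁, r₂} := Subgroup.subset_closure (by simp)
    have hm₁ : r₁ ∈ Subgroup.closure {r₀, r₁, r₂} := Subgroup.subset_closure (by simp)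
    have hm₂ : r₂ ∈ Subgroup.closure {r₀, r₁, r₂} := Subgroup.subset_closure (by simp)
    rintro x (rfl | rfl)
    · exact mul_mem hm₀ hm₂
    · exact mul_mem hm₁ hm₂
  · apply le_antisymm
    · rintro x ⟨hxA, hxB⟩
      replace hxA := Finset.mem_coe.mp (hA.subset hxA)
      replace hxB := Finset.mem_coe.mp (hB.subset hxB)
      have key : ∀ y ∈ dihedralFinset r₁ r₂ 2, y ∈ dihedralFinset r₀ r₂ 5 → y = 1 ∨ y = r₂ := by
        subst hr₀ hr₁ hr₂; decide +kernel
      rcases key x hxA hxB with rfl | rfl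
      · exact one_mem _
      · exact Subgroup.subset_closure rfl
    · exact le_inf (Subgroup.closure_mono (by simp)) (Subgroup.closure_mono (by simp))
  · rw [hA, hB]
    have key : (dihedralFinset r₁ r₂ 2 * dihedralFinset r₀ r₂ 5) ∩
        (dihedralFinset r₀ r₂ 5 * dihedralFinset r₁ r₂ 2) =
        dihedralFinset r₁ r₂ 2 ∪ dihedralFinset r₀ r₂ 5 := by
      subst hr₀ hr₁ hr₂; decide +kernel
    exact_mod_cast key
  · exact orderOf_eq_prime h₁₂ (by subst hr₁ hr₂; decide +kernel)
  · have : Fact (Nat.Prime 5) := ⟨by norm_num⟩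
    exact orderOf_eq_prime h₀₂ (by subst hr₀ hr₂; decide +kernel)
  · rw [orderOf_eq_iff (by norm_num)]
    exact ⟨h₀₁, by subst hr₀ hr₁; decide +kernel⟩
  · refine index_closure_pair h₁ h₂ two_ne_zero h₁₂ ?_
    rw [card_alternatingGroup_five_prod]
    subst hr₁ hr₂; decide +kernel
  · refine index_closure_pair h₀ h₂ (by norm_num) h₀₂ ?_
    rw [card_alternatingGroup_five_prod]
    subst hr₀ hr₂; decide +kernel
  · refine index_closure_pair h₀ h₁ (by norm_num) h₀₁ ?_
    rw [card_alternatingGroup_five_prod]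
    subst hr₀ hr₁; decide +kernel
end
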